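/- Let p > 6, μ > 0 and ℓ > 0. Then for Lebesgue-almost every ρ ∈ [1/2, 1] there exist λ_ρ > 0 and a function u_ρ : ℝ → ℝ such that: u_ρ is continuously differentiable on ℝ and twice differentiable at every point of ℝ ∖ {0, ℓ}; u_ρ(x) > 0 for all x ∈ ℝ; u_ρ and u_ρ' are square-integrable; ∫_ℝ u_ρ² dx = μ; −u_ρ''(x) + λ_ρ·u_ρ(x) = ρ·χ_{[0,ℓ]}(x)·u_ρ(x)^{p−1} for every x ∈ ℝ ∖ {0, ℓ}; and the Morse index of u_ρ is at most 2, in the sense that every finite-dimensional subspace W of the space of compactly supported continuously differentiable functions φ : ℝ → ℝ satisfying ∫_ℝ ( |φ'|² + (λ_ρ − (p−1)·ρ·χ_{[0,ℓ]}·u_ρ^{p−2})·φ² ) dx < 0 for all φ ∈ W ∖ {0} has dimension at most 2. -/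

import Mathlib

open MeasureTheory Set Filter

lemma inv_aux (f f' : ℝ → ℝ) (c : ℝ) (hc : 0 < c) (hf : ∀ x, HasDerivAt f (f' x) x)
    (hf' : ∀ x, c ≤ f' x) :
    ∃ g : ℝ → ℝ, Continuous g ∧ StrictMono g ∧ (∀ x, g (f x) = x) ∧ (∀ y, f (g y) = y) ∧
      ∀ y, HasDerivAt g (f' (g y))⁻¹ y := by
  have hcont : Continuous f := continuous_iff_continuousAt.2 fun x => (hf x).continuousAt
  have hpos : ∀ x, 0 < f' x := fun x => hc.trans_le (hf' x)
  have hmono : StrictMono f := strictMono_of_deriv_pos fun x => by rw [(hf x).deriv]; exact hpos x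
  have hm : Monotone (fun x => f x - c * x) := by
    apply monotone_of_deriv_nonneg
    · intro x
      exact ((hf x).differentiableAt).sub ((differentiableAt_id).const_mul c)
    · intro x
      have : HasDerivAt (fun x => f x - c * x) (f' x - c * 1) x :=
        (hf x).sub ((hasDerivAt_id x).const_mul c)
      rw [this.deriv]
      have := hf' x
      linarith
  have htop : Tendsto f atTop atTop := by
    have h1 : Tendsto (fun x : ℝ => f 0 + c * x) atTop atTop :=
      tendsto_atTop_add_const_left _ _ (tendsto_id.const_mul_atTop hc)
    refine tendsto_atTop_mono' _ ?_ h1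
    filter_upwards [eventually_ge_atTop 0] with x hx
    have := hm hx
    simp at this
    linarith
  have hbot : Tendsto f atBot atBot := by
    have h1 : Tendsto (fun x : ℝ => f 0 + c * x) atBot atBot :=
      tendsto_atBot_add_const_left _ _ (tendsto_id.const_mul_atBot hc)
    refine tendsto_atBot_mono' _ ?_ h1
    filter_upwards [eventually_le_atBot 0] with x hx
    have := hm hx
    simp at this
    linarith
  have hsurj := hcont.surjective htop hbot
  let e := hmono.orderIsoOfSurjective f hsurj
  have he : ∀ x, e x = f x := fun x => rfl
  have hfe : ∀ y, f (e.symm y) = y := fun y => by rw [← he]; exact e.apply_symm_apply y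
  refine ⟨e.symm, e.symm.continuous, e.symm.strictMono, fun x => e.symm_apply_apply x, hfe, ?_⟩
  intro y
  exact HasDerivAt.of_local_left_inverse e.symm.continuous.continuousAt (hf _)
    (hpos _).ne' (Eventually.of_forall hfe)

noncomputable def DD (p t : ℝ) : ℝ := (p - 2) * Real.exp ((p - 2) * t) + 2 * Real.exp (-2 * t)

lemma DD_ge (p t : ℝ) (hp : 6 < p) : 2 ≤ DD p t := by
  unfold DD
  have h1 := Real.exp_pos ((p - 2) * t)
  have h2 := Real.exp_pos (-2 * t)
  rcases le_total 0 t with h | h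
  · have : 1 ≤ Real.exp ((p - 2) * t) := Real.one_le_exp (by nlinarith)
    nlinarith
  · have : 1 ≤ Real.exp (-2 * t) := Real.one_le_exp (by nlinarith)
    nlinarith

structure IsK (p : ℝ) (k : ℝ → ℝ) : Prop where
  cont : Continuous k
  mono : StrictMono k
  eq : ∀ y, Real.exp ((p - 2) * k y) - Real.exp (-2 * k y) = y
  inv : ∀ t, k (Real.exp ((p - 2) * t) - Real.exp (-2 * t)) = t
  der : ∀ y, HasDerivAt k (DD p (k y))⁻¹ y

lemma exists_k (p : ℝ) (hp : 6 < p) : ∃ k, IsK p k := by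
  obtain ⟨g, h1, h2, h3, h4, h5⟩ := inv_aux
    (fun t => Real.exp ((p - 2) * t) - Real.exp (-2 * t)) (DD p) 2 two_pos (by
      intro x
      have a1 : HasDerivAt (fun t : ℝ => Real.exp ((p - 2) * t))
        (Real.exp ((p - 2) * x) * ((p - 2) * 1)) x := ((hasDerivAt_id x).const_mul (p-2)).exp
      have a2 : HasDerivAt (fun t : ℝ => Real.exp (-2 * t))
        (Real.exp (-2 * x) * (-2 * 1)) x := ((hasDerivAt_id x).const_mul (-2)).exp
      have := a1.sub a2
      refine this.congr_deriv ?_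
      unfold DD; ring) (fun x => DD_ge p x hp)
  exact ⟨g, h1, h2, h4, h3, h5⟩

lemma IsK.zero {p : ℝ} {k : ℝ → ℝ} (h : IsK p k) : k 0 = 0 := by
  have := h.inv 0
  simpa using this

lemma IsK.nonneg {p : ℝ} {k : ℝ → ℝ} (h : IsK p k) {y : ℝ} (hy : 0 ≤ y) : 0 ≤ k y := by
  rw [← h.zero]; exact h.mono.monotone hy

/-- the derivative of `q` along the trajectory -/
noncomputable def FF (p : ℝ) (k : ℝ → ℝ) (s q : ℝ) : ℝ :=
  Real.exp s / 2 * DD p (k ((1 - q ^ 2) / Real.exp s))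

noncomputable def TT (p : ℝ) (k : ℝ → ℝ) (s : ℝ) : ℝ := ∫ q in (0:ℝ)..1, (FF p k s q)⁻¹

noncomputable def NN (p : ℝ) (k : ℝ → ℝ) (s : ℝ) : ℝ :=
  ∫ q in (0:ℝ)..1, Real.exp (2 * k ((1 - q ^ 2) / Real.exp s)) * (FF p k s q)⁻¹

lemma FF_pos {p : ℝ} (hp : 6 < p) (k : ℝ → ℝ) (s q : ℝ) : 0 < FF p k s q := by
  unfold FF
  have := DD_ge p (k ((1 - q ^ 2) / Real.exp s)) hp
  have := Real.exp_pos s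
  positivity

lemma FF_ge {p : ℝ} (hp : 6 < p) (k : ℝ → ℝ) (s q : ℝ) : Real.exp s ≤ FF p k s q := by
  unfold FF
  have := DD_ge p (k ((1 - q ^ 2) / Real.exp s)) hp
  have := Real.exp_pos s
  nlinarith

lemma FF_le {p : ℝ} (hp : 6 < p) {k : ℝ → ℝ} (hk : IsK p k) (s q : ℝ) (hq : q ^ 2 ≤ 1) :
    FF p k s q ≤ p / 2 * (1 - q ^ 2 + Real.exp s) := by
  have hs := Real.exp_pos s
  set y := (1 - q ^ 2) / Real.exp s with hy
  have hy0 : 0 ≤ y := div_nonneg (by linarith) hs.le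
  have h1 := hk.eq y
  have h2 := hk.nonneg hy0
  have h3 : Real.exp (-2 * k y) ≤ 1 := Real.exp_le_one_iff.2 (by linarith)
  have h4 : y * Real.exp s = 1 - q ^ 2 := by rw [hy]; field_simp
  have h5 : DD p (k y) ≤ p * (y + 1) := by
    unfold DD
    have : Real.exp ((p - 2) * k y) = y + Real.exp (-2 * k y) := by linarith
    rw [this]
    nlinarith
  have : FF p k s q = Real.exp s / 2 * DD p (k y) := rfl
  rw [this]
  have : Real.exp s / 2 * DD p (k y) ≤ Real.exp s / 2 * (p * (y + 1)) := by gcongr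
  nlinarith

lemma FF_cont (p : ℝ) {k : ℝ → ℝ} (hk : IsK p k) :
    Continuous (fun z : ℝ × ℝ => FF p k z.1 z.2) := by
  unfold FF DD
  have hk' := hk.cont
  have : Continuous fun z : ℝ × ℝ => k ((1 - z.2 ^ 2) / Real.exp z.1) := by
    apply hk'.comp
    exact Continuous.div (by fun_prop) (by fun_prop) (fun z => (Real.exp_pos _).ne')
  have e : Continuous fun z : ℝ × ℝ => Real.exp z.1 / 2 := by fun_prop
  exact e.mul ((continuous_const.mul (Real.continuous_exp.comp (continuous_const.mul this))).add
    (continuous_const.mul (Real.continuous_exp.comp (continuous_const.mul this))))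

lemma FF_cont1 (p : ℝ) {k : ℝ → ℝ} (hk : IsK p k) (s : ℝ) :
    Continuous (fun q : ℝ => FF p k s q) :=
  (FF_cont p hk).comp (by fun_prop : Continuous fun q : ℝ => (s, q))

lemma TT_cont {p : ℝ} (hp : 6 < p) {k : ℝ → ℝ} (hk : IsK p k) : Continuous (TT p k) := by
  unfold TT
  apply intervalIntegral.continuous_parametric_intervalIntegral_of_continuous'
  exact (FF_cont p hk).inv₀ (fun z => (FF_pos hp k _ _).ne')

lemma NN_cont {p : ℝ} (hp : 6 < p) {k : ℝ → ℝ} (hk : IsK p k) : Continuous (NN p k) := by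
  unfold NN
  apply intervalIntegral.continuous_parametric_intervalIntegral_of_continuous'
  have : Continuous fun z : ℝ × ℝ => k ((1 - z.2 ^ 2) / Real.exp z.1) := by
    apply hk.cont.comp
    exact Continuous.div (by fun_prop) (by fun_prop) (fun z => (Real.exp_pos _).ne')
  exact (Real.continuous_exp.comp (continuous_const.mul this)).mul
    ((FF_cont p hk).inv₀ (fun z => (FF_pos hp k _ _).ne'))

lemma FFinv_int {p : ℝ} (hp : 6 < p) {k : ℝ → ℝ} (hk : IsK p k) (s a b : ℝ) :
    IntervalIntegrable (fun q => (FF p k s q)⁻¹) volume a b :=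
  ((FF_cont1 p hk s).inv₀ (fun z => (FF_pos hp k _ _).ne')).intervalIntegrable _ _

lemma TT_pos {p : ℝ} (hp : 6 < p) {k : ℝ → ℝ} (hk : IsK p k) (s : ℝ) : 0 < TT p k s := by
  apply intervalIntegral.intervalIntegral_pos_of_pos_on (FFinv_int hp hk s 0 1)
  · intro x _
    exact inv_pos.2 (FF_pos hp k _ _)
  · norm_num

lemma NN_nonneg {p : ℝ} (hp : 6 < p) {k : ℝ → ℝ} (s : ℝ) : 0 ≤ NN p k s := by
  apply intervalIntegral.integral_nonneg (by norm_num)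
  intro x _
  have := FF_pos hp k s x
  positivity

lemma TT_le {p : ℝ} (hp : 6 < p) {k : ℝ → ℝ} (hk : IsK p k) (s : ℝ) : TT p k s ≤ Real.exp (-s) := by
  have : TT p k s ≤ ∫ q in (0:ℝ)..1, Real.exp (-s) := by
    apply intervalIntegral.integral_mono_on (by norm_num) (FFinv_int hp hk s 0 1) (by simp)
    intro q _
    rw [Real.exp_neg]
    exact inv_anti₀ (Real.exp_pos s) (FF_ge hp k s q)
  simpa using this

lemma TT_ge {p : ℝ} (hp : 6 < p) {k : ℝ → ℝ} (hk : IsK p k) (s : ℝ) : -s / p ≤ TT p k s := by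
  have hs := Real.exp_pos s
  have h0 : ∀ q ∈ Icc (0:ℝ) 1, 0 < 1 - q + Real.exp s := by
    intro q hq; have := hq.2; linarith
  have hc : ContinuousOn (fun q => p⁻¹ * (1 - q + Real.exp s)⁻¹) (uIcc (0:ℝ) 1) := by
    rw [uIcc_of_le zero_le_one]
    refine continuousOn_const.mul (ContinuousOn.inv₀ (by fun_prop) (fun q hq => (h0 q hq).ne'))
  have h1 : ∫ q in (0:ℝ)..1, p⁻¹ * (1 - q + Real.exp s)⁻¹ ≤ TT p k s := by
    apply intervalIntegral.integral_mono_on (by norm_num) hc.intervalIntegrable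
      (FFinv_int hp hk s 0 1)
    intro q hq
    have h2 := FF_le hp hk s q (by nlinarith [hq.1, hq.2])
    rw [← mul_inv]
    apply inv_anti₀ (FF_pos hp k s q)
    refine h2.trans ?_
    have : 1 - q ^ 2 + Real.exp s ≤ 2 * (1 - q + Real.exp s) := by nlinarith [sq_nonneg (1 - q)]
    nlinarith
  have h2 : ∫ q in (0:ℝ)..1, p⁻¹ * (1 - q + Real.exp s)⁻¹
      = -p⁻¹ * Real.log (1 - 1 + Real.exp s) - -p⁻¹ * Real.log (1 - 0 + Real.exp s) := by
    refine intervalIntegral.integral_eq_sub_of_hasDerivAt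
      (f := fun q => -p⁻¹ * Real.log (1 - q + Real.exp s)) ?_ hc.intervalIntegrable
    intro q hq
    rw [uIcc_of_le zero_le_one] at hq
    have a1 : HasDerivAt (fun q => 1 - q + Real.exp s) (-1) q :=
      ((hasDerivAt_id q).const_sub 1).add_const _
    refine ((a1.log (h0 q hq).ne').const_mul (-p⁻¹)).congr_deriv ?_
    have := (h0 q hq).ne'
    field_simp
  rw [h2] at h1
  refine le_trans ?_ h1
  simp
  have : 0 ≤ Real.log (1 + Real.exp s) := Real.log_nonneg (by linarith)
  have hp' : 0 < p⁻¹ := by positivity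
  have : 0 ≤ p⁻¹ * Real.log (1 + Real.exp s) := by positivity
  have e : -s / p = -(p⁻¹ * s) := by field_simp
  rw [e]
  linarith

lemma NN_bound {p : ℝ} (hp : 6 < p) {k : ℝ → ℝ} (hk : IsK p k) :
    ∃ C : ℝ, 0 ≤ C ∧ ∀ s, Real.exp s ^ (2 / (p - 2)) * NN p k s ≤ C := by
  set θ : ℝ := -((p - 4) / (p - 2)) with hθ
  have hθ1 : -1 < θ := by
    rw [hθ, neg_lt_neg_iff, div_lt_one (by linarith)]; linarith
  have hI : IntervalIntegrable (fun q : ℝ => (1 - q) ^ θ) volume 0 1 := by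
    have := (intervalIntegral.intervalIntegrable_rpow' (a := 0) (b := 1) hθ1)
    have := this.comp_sub_left 1
    simpa using this.symm
  refine ⟨∫ q in (0:ℝ)..1, (1 - q) ^ θ, ?_, ?_⟩
  · apply intervalIntegral.integral_nonneg (by norm_num)
    intro q hq
    exact Real.rpow_nonneg (by linarith [hq.2]) _
  intro s
  have hs := Real.exp_pos s
  unfold NN
  rw [← intervalIntegral.integral_const_mul]
  have hc : Continuous fun q : ℝ => k ((1 - q ^ 2) / Real.exp s) :=
    hk.cont.comp (by fun_prop)
  apply intervalIntegral.integral_mono_on_of_le_Ioo (by norm_num)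
  · apply Continuous.intervalIntegrable
    exact continuous_const.mul ((Real.continuous_exp.comp (continuous_const.mul hc)).mul
      ((FF_cont1 p hk s).inv₀ (fun z => (FF_pos hp k _ _).ne')))
  · exact hI
  intro q hq
  have hq2 : q ^ 2 < 1 := by nlinarith [hq.1, hq.2]
  unfold FF
  set y := (1 - q ^ 2) / Real.exp s with hy
  have hy0 : 0 < y := div_pos (by linarith) hs
  have h1 := hk.eq y
  set κ := k y
  have e2 := Real.exp_pos (-2 * κ)
  have h3 : y ≤ Real.exp ((p - 2) * κ) := by linarith
  have hD : Real.exp s / 2 * (2 * Real.exp ((p - 2) * κ)) ≤ Real.exp s / 2 * DD p κ := by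
    unfold DD
    have := Real.exp_pos ((p - 2) * κ)
    gcongr
    nlinarith
  have h4 : (Real.exp s / 2 * DD p κ)⁻¹ ≤ (Real.exp s)⁻¹ * Real.exp (-((p - 2) * κ)) := by
    refine (inv_anti₀ (by positivity) hD).trans (le_of_eq ?_)
    rw [Real.exp_neg]
    field_simp
  have h5 : Real.exp (2 * κ) * Real.exp (-((p - 2) * κ)) = (Real.exp ((p - 2) * κ)) ^ θ := by
    rw [← Real.exp_add, ← Real.exp_mul, hθ]
    congr 1
    have : p - 2 ≠ 0 := by linarith
    field_simp
    ring
  have h6 : (Real.exp ((p - 2) * κ)) ^ θ ≤ y ^ θ :=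
    Real.rpow_le_rpow_of_nonpos hy0 h3 (by
      rw [hθ]; apply neg_nonpos.2; exact div_nonneg (by linarith) (by linarith))
  have h7 : y ^ θ = (1 - q ^ 2) ^ θ * (Real.exp s) ^ (-θ) := by
    rw [hy, Real.div_rpow (by linarith) hs.le, Real.rpow_neg hs.le θ, div_eq_mul_inv]
  have h8 : (1 - q ^ 2) ^ θ ≤ (1 - q) ^ θ :=
    Real.rpow_le_rpow_of_nonpos (by linarith [hq.2]) (by nlinarith [hq.1, hq.2]) (by
      rw [hθ]; apply neg_nonpos.2; exact div_nonneg (by linarith) (by linarith))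
  have h9 : Real.exp s ^ (2 / (p - 2)) * ((Real.exp s)⁻¹ * (Real.exp s) ^ (-θ)) = 1 := by
    rw [← Real.rpow_neg_one, ← Real.rpow_add hs, ← Real.rpow_add hs]
    have : 2 / (p - 2) + (-1 + -θ) = 0 := by
      rw [hθ]
      have : p - 2 ≠ 0 := by linarith
      field_simp
      ring
    rw [this, Real.rpow_zero]
  have hb := Real.rpow_pos_of_pos hs (2 / (p - 2))
  calc Real.exp s ^ (2 / (p - 2)) * (Real.exp (2 * κ) * (Real.exp s / 2 * DD p κ)⁻¹)
      ≤ Real.exp s ^ (2 / (p - 2)) *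
        (Real.exp (2 * κ) * ((Real.exp s)⁻¹ * Real.exp (-((p - 2) * κ)))) := by gcongr
    _ = Real.exp s ^ (2 / (p - 2)) * ((Real.exp s)⁻¹ *
        (Real.exp (2 * κ) * Real.exp (-((p - 2) * κ)))) := by ring
    _ ≤ Real.exp s ^ (2 / (p - 2)) * ((Real.exp s)⁻¹ * y ^ θ) := by rw [h5]; gcongr
    _ = (Real.exp s ^ (2 / (p - 2)) * ((Real.exp s)⁻¹ * (Real.exp s) ^ (-θ))) * (1 - q ^ 2) ^ θ := by
        rw [h7]; ring
    _ = (1 - q ^ 2) ^ θ := by rw [h9, one_mul]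
    _ ≤ (1 - q) ^ θ := h8

structure IsProf (p β T N : ℝ) (t θ : ℝ → ℝ) : Prop where
  cont : Continuous θ
  der : ∀ x, HasDerivAt t (-θ x) x
  odd : ∀ x, θ (-x) = -θ x
  even : ∀ x, t (-x) = t x
  pos : ∀ x, 0 < x → 0 < θ x
  sq : ∀ x, θ x ^ 2 ≤ 1
  one : ∀ x, T ≤ x → θ x = 1
  der2 : ∀ x, |x| < T → HasDerivAt θ (β / 2 * DD p (t x)) x
  en : ∀ x, |x| ≤ T → 1 - θ x ^ 2 = β * (Real.exp ((p - 2) * t x) - Real.exp (-2 * t x))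
  tail : ∀ x, T ≤ x → t x = T - x
  mass : ∫ x in (0:ℝ)..T, Real.exp (2 * t x) = N

lemma exists_prof {p : ℝ} (hp : 6 < p) {k : ℝ → ℝ} (hk : IsK p k) (s : ℝ) :
    ∃ t θ, IsProf p (Real.exp s) (TT p k s) (NN p k s) t θ := by
  have hs := Real.exp_pos s
  set cl : ℝ → ℝ := fun q => max (-1) (min q 1) with hcl
  have clc : Continuous cl := by fun_prop
  have cl_id : ∀ q, -1 ≤ q → q ≤ 1 → cl q = q := by
    intro q h1 h2; simp [hcl, h1, h2]
  have cl_one : ∀ q, 1 ≤ q → cl q = 1 := by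
    intro q h1; simp only [hcl]; rw [min_eq_right h1]; norm_num
  have cl_odd : ∀ q, cl (-q) = - cl q := by
    intro q
    rcases le_total q 1 with h1 | h1
    · rcases le_total (-1) q with h2 | h2
      · rw [cl_id q h2 h1, cl_id (-q) (by linarith) (by linarith)]
      · rw [cl_one (-q) (by linarith)]
        simp only [hcl]; rw [min_eq_left h1, max_eq_left h2]; norm_num
    · rw [cl_one q h1]
      simp only [hcl]; rw [min_eq_left (by linarith), max_eq_left (by linarith)]
  have cl_sq : ∀ q, cl q ^ 2 ≤ 1 := by
    intro q
    have h1 : -1 ≤ cl q := le_max_left _ _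
    have h2 : cl q ≤ 1 := max_le (by norm_num) (min_le_right _ _)
    nlinarith
  set G : ℝ → ℝ := fun q => (FF p k s (cl q))⁻¹ with hG
  have Gc : Continuous G :=
    ((FF_cont1 p hk s).comp clc).inv₀ (fun z => (FF_pos hp k _ _).ne')
  have Gge : ∀ q, (p / 2 * (1 + Real.exp s))⁻¹ ≤ G q := by
    intro q
    apply inv_anti₀ (FF_pos hp k _ _)
    refine (FF_le hp hk s (cl q) (cl_sq q)).trans ?_
    have := sq_nonneg (cl q)
    gcongr
    linarith
  have Gev : ∀ q, G (-q) = G q := by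
    intro q; simp only [hG, cl_odd]; unfold FF; simp
  set X : ℝ → ℝ := fun q => ∫ r in (0:ℝ)..q, G r with hX
  have Xd : ∀ q, HasDerivAt X (G q) q := fun q => (Gc.integral_hasStrictDerivAt 0 q).hasDerivAt
  obtain ⟨Q, Qc, Qm, QX, XQ, Qd⟩ := inv_aux X G _ (by positivity) Xd Gge
  have X0 : X 0 = 0 := by simp [hX]
  have X1 : X 1 = TT p k s := by
    simp only [hX, TT]
    apply intervalIntegral.integral_congr
    intro q hq
    rw [uIcc_of_le zero_le_one] at hq
    simp only [hG]
    rw [cl_id q (by linarith [hq.1]) hq.2]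
  have Xodd : ∀ q, X (-q) = - X q := by
    intro q
    have h1 : ∫ r in (0:ℝ)..q, G (-r) = ∫ r in (-q)..(-0), G r :=
      intervalIntegral.integral_comp_neg G
    simp only [Gev, neg_zero] at h1
    simp only [hX]
    rw [h1, intervalIntegral.integral_symm]
  have Q0 : Q 0 = 0 := by have := QX 0; rwa [X0] at this
  have QT : Q (TT p k s) = 1 := by rw [← X1, QX]
  have Qodd : ∀ x, Q (-x) = - Q x := by
    intro x
    conv_lhs => rw [← XQ x, ← Xodd, QX]
  have Tpos := TT_pos hp hk s
  set T := TT p k s with hT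
  set θ : ℝ → ℝ := fun x => cl (Q x) with hθ
  have θc : Continuous θ := clc.comp Qc
  have θodd : ∀ x, θ (-x) = -θ x := by intro x; simp only [hθ, Qodd, cl_odd]
  have θ0 : θ 0 = 0 := by simp only [hθ, Q0]; exact cl_id 0 (by norm_num) (by norm_num)
  set t : ℝ → ℝ := fun x => k (1 / Real.exp s) - ∫ r in (0:ℝ)..x, θ r with ht
  have td : ∀ x, HasDerivAt t (-θ x) x := fun x =>
    ((θc.integral_hasStrictDerivAt 0 x).hasDerivAt).const_sub _
  have t0 : t 0 = k (1 / Real.exp s) := by simp [ht]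
  have teven : ∀ x, t (-x) = t x := by
    have hd : ∀ x, HasDerivAt (fun x => t (-x) - t x) 0 x := by
      intro x
      have h1 : HasDerivAt (fun x => t (-x)) (-θ (-x) * (-1)) x :=
        (td (-x)).comp x (hasDerivAt_neg x)
      refine (h1.sub (td x)).congr_deriv ?_
      rw [θodd]; ring
    intro x
    have := is_const_of_deriv_eq_zero (fun x => (hd x).differentiableAt) (fun x => (hd x).deriv) x 0
    simp only [neg_zero, sub_self] at this
    linarith
  have Qlt : ∀ x, |x| < T → -1 < Q x ∧ Q x < 1 := by
    intro x hx
    rw [abs_lt] at hx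
    refine ⟨?_, by rw [← QT]; exact Qm hx.2⟩
    rw [← QT, ← Qodd]; exact Qm hx.1
  have θeq : ∀ x, |x| < T → θ =ᶠ[nhds x] Q := by
    intro x hx
    have : {y : ℝ | |y| < T} ∈ nhds x := (isOpen_lt continuous_abs continuous_const).mem_nhds hx
    filter_upwards [this] with y hy
    exact cl_id _ (Qlt y hy).1.le (Qlt y hy).2.le
  have θd : ∀ x, |x| < T → HasDerivAt θ (FF p k s (θ x)) x := by
    intro x hx
    have := Qd x
    have h2 := this.congr_of_eventuallyEq (θeq x hx)
    simpa [hG] using h2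
  have tk0 : ∀ x ∈ Icc 0 T, t x = k ((1 - θ x ^ 2) / Real.exp s) := by
    have hc : ContinuousOn (fun x => t x - k ((1 - θ x ^ 2) / Real.exp s)) (Icc 0 T) := by
      apply Continuous.continuousOn
      have h1 : Continuous t := continuous_iff_continuousAt.2 fun x => (td x).continuousAt
      have h2 := hk.cont
      exact h1.sub (h2.comp (by fun_prop))
    have := constant_of_has_deriv_right_zero hc (by
      intro x hx
      have hx' : |x| < T := by rw [abs_of_nonneg hx.1]; exact hx.2
      have h1 : HasDerivAt (fun x => (1 - θ x ^ 2) / Real.exp s)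
          (-(2 * θ x * FF p k s (θ x)) / Real.exp s) x := by
        have := (((θd x hx').pow 2).const_sub 1).div_const (Real.exp s)
        refine this.congr_deriv ?_
        simp
      have h2 : HasDerivAt (fun x => k ((1 - θ x ^ 2) / Real.exp s)) _ x := (hk.der _).comp x h1
      refine (((td x).sub h2).congr_deriv ?_).hasDerivWithinAt
      have := DD_ge p (k ((1 - θ x ^ 2) / Real.exp s)) hp
      have h3 : DD p (k ((1 - θ x ^ 2) / Real.exp s)) ≠ 0 := by linarith
      unfold FF
      field_simp
      ring)
    intro x hx
    have := this x hx
    simp only [θ0, t0] at this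
    norm_num at this
    linarith
  have tk : ∀ x, |x| ≤ T → t x = k ((1 - θ x ^ 2) / Real.exp s) := by
    intro x hx
    rw [abs_le] at hx
    rcases le_total 0 x with h | h
    · exact tk0 x ⟨h, hx.2⟩
    · have := tk0 (-x) ⟨by linarith, by linarith⟩
      rw [teven, θodd] at this
      simpa using this
  have θone : ∀ x, T ≤ x → θ x = 1 := by
    intro x hx
    apply cl_one
    rw [← QT]; exact Qm.monotone hx
  have tT : t T = 0 := by
    rw [tk T (by rw [abs_of_pos Tpos]), θone T le_rfl]
    simp [hk.zero]
  refine ⟨t, θ, θc, td, θodd, teven, ?_, fun x => cl_sq _, θone, ?_, ?_, ?_, ?_⟩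
  · intro x hx
    have : 0 < Q x := by rw [← Q0]; exact Qm hx
    simp only [hθ, hcl]
    exact lt_max_of_lt_right (lt_min this one_pos)
  · intro x hx
    have := θd x hx
    unfold FF at this
    rwa [← tk x hx.le] at this
  · intro x hx
    have := hk.eq ((1 - θ x ^ 2) / Real.exp s)
    rw [tk x hx, this]
    field_simp
  · intro x hx
    have hd : ∀ y ∈ Ico T x, HasDerivWithinAt (fun y => t y + y) 0 (Ici y) y := by
      intro y hy
      refine (((td y).add (hasDerivAt_id y)).congr_deriv ?_).hasDerivWithinAt
      rw [θone y hy.1]; ring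
    have h1 : Continuous t := continuous_iff_continuousAt.2 fun x => (td x).continuousAt
    have := constant_of_has_deriv_right_zero (by fun_prop) hd x ⟨hx, le_rfl⟩
    simp only [tT] at this
    linarith
  · have h1 : Continuous t := continuous_iff_continuousAt.2 fun x => (td x).continuousAt
    have := intervalIntegral.integral_comp_mul_deriv (a := 0) (b := 1) (f := X) (f' := G)
      (g := fun x => Real.exp (2 * t x)) (fun x _ => Xd x) Gc.continuousOn (by fun_prop)
    rw [X0, X1] at this
    rw [← this]
    unfold NN
    apply intervalIntegral.integral_congr
    intro q hq
    rw [uIcc_of_le zero_le_one] at hq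
    have hcq := cl_id q (by linarith [hq.1]) hq.2
    have hXq : |X q| ≤ T := by
      have hXm : StrictMono X := by
        intro a b hab
        by_contra hcon
        have := Qm.monotone (not_lt.1 hcon)
        rw [QX, QX] at this
        linarith
      have a1 := hXm.monotone hq.1
      have a2 := hXm.monotone hq.2
      rw [X0] at a1
      rw [X1] at a2
      rw [abs_of_nonneg a1]; exact a2
    have := tk _ hXq
    simp only [hθ, QX, hcq] at this
    simp only [Function.comp, this, hG, hcq]

lemma half_inner {p lam σ ρ L : ℝ} {u v φ : ℝ → ℝ} (hσ : 0 < σ) (hlam : lam = σ ^ 2)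
    (hL : 0 < L) (hρ : 0 < ρ) (hu : ∀ x, HasDerivAt u (v x) x) (hvc : Continuous v)
    (hup : ∀ x, 0 < u x) (hv0 : v 0 = 0) (hvn : ∀ x, 0 < x → v x < 0) (hvL : v L = -σ * u L)
    (hv : ∀ x, 0 ≤ x → x < L → HasDerivAt v (lam * u x - ρ * u x ^ (p - 1)) x)
    (hn0 : lam * u 0 - ρ * u 0 ^ (p - 1) ≠ 0)
    (hφ : ContDiff ℝ 1 φ) (hφ0 : φ 0 = 0) :
    -σ * φ L ^ 2 ≤ ∫ x in (0:ℝ)..L,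
      ((deriv φ x) ^ 2 + (lam - (p - 1) * ρ * u x ^ (p - 2)) * φ x ^ 2) := by
  have huc : Continuous u := continuous_iff_continuousAt.2 fun x => (hu x).continuousAt
  have hφc := hφ.continuous
  have hφ'c : Continuous (deriv φ) := hφ.continuous_deriv le_rfl
  have hφd : ∀ x, HasDerivAt φ (deriv φ x) x := fun x =>
    (hφ.differentiable one_ne_zero x).hasDerivAt
  have hupc : ∀ r : ℝ, Continuous fun x => u x ^ r := fun r =>
    huc.rpow_const (fun x => Or.inl (hup x).ne')
  set I : ℝ → ℝ := fun x => (deriv φ x) ^ 2 + (lam - (p - 1) * ρ * u x ^ (p - 2)) * φ x ^ 2 with hI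
  have hIc : Continuous I := by
    have := hupc (p - 2)
    fun_prop
  set n : ℝ → ℝ := fun x => lam * u x - ρ * u x ^ (p - 1) with hn
  have hnc : Continuous n := by
    have := hupc (p - 1)
    fun_prop
  have hnd : ∀ x, HasDerivAt n ((lam - (p - 1) * ρ * u x ^ (p - 2)) * v x) x := by
    intro x
    have h1 := (hu x).rpow_const (p := p - 1) (Or.inl (hup x).ne')
    refine (((hu x).const_mul lam).sub (h1.const_mul ρ)).congr_deriv ?_
    have : p - 1 - 1 = p - 2 := by ring
    rw [this]; ring
  set G : ℝ → ℝ := fun x => n x / v x * φ x ^ 2 with hG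
  have key : ∀ ε, 0 < ε → ε < L → G L - G ε ≤ ∫ x in ε..L, I x := by
    intro ε hε hεL
    refine intervalIntegral.sub_le_integral_of_hasDeriv_right_of_le hεL.le
      (g' := fun x => I x - (deriv φ x - n x / v x * φ x) ^ 2) ?_ ?_ ?_ ?_
    · apply ContinuousOn.mul _ (by fun_prop)
      exact hnc.continuousOn.div hvc.continuousOn
        (fun x hx => (hvn x (hε.trans_le hx.1)).ne)
    · intro x hx
      have hx0 : 0 < x := hε.trans hx.1
      have hvx : v x ≠ 0 := (hvn x hx0).ne
      have h1 := ((hnd x).div (hv x hx0.le hx.2) hvx).mul ((hφd x).pow 2)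
      refine (h1.congr_deriv ?_).hasDerivWithinAt
      have e : lam * u x - ρ * u x ^ (p - 1) = n x := rfl
      simp only [hI, e]
      simp
      field_simp
      ring
    · exact hIc.continuousOn.integrableOn_Icc
    · intro x _
      have := sq_nonneg (deriv φ x - n x / v x * φ x)
      linarith
  have hGlim : Tendsto G (nhdsWithin 0 (Ioi 0)) (nhds 0) := by
    have h1 : Tendsto (slope φ 0) (nhdsWithin 0 (Ioi 0)) (nhds (deriv φ 0)) :=
      (hasDerivAt_iff_tendsto_slope.1 (hφd 0)).mono_left
        (nhdsWithin_mono _ (fun x hx => ne_of_gt hx))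
    have h2 : Tendsto (slope v 0) (nhdsWithin 0 (Ioi 0)) (nhds (n 0)) :=
      (hasDerivAt_iff_tendsto_slope.1 (hv 0 le_rfl hL)).mono_left
        (nhdsWithin_mono _ (fun x hx => ne_of_gt hx))
    have h3 : Tendsto (fun x => n x * φ x) (nhdsWithin 0 (Ioi 0)) (nhds (n 0 * φ 0)) :=
      ((hnc.mul hφc).tendsto 0).mono_left nhdsWithin_le_nhds
    have h4 := h3.mul (h1.div h2 hn0)
    rw [hφ0] at h4
    simp only [mul_zero, zero_mul] at h4
    refine h4.congr' ?_
    filter_upwards [self_mem_nhdsWithin] with x hx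
    have hx0 : x ≠ 0 := ne_of_gt hx
    have hvx := (hvn x hx).ne
    simp only [slope_def_field, hφ0, hv0, sub_zero, Pi.div_apply, hG]
    field_simp
  have hIlim : Tendsto (fun ε => ∫ x in ε..L, I x) (nhdsWithin 0 (Ioi 0))
      (nhds (∫ x in (0:ℝ)..L, I x)) := by
    have : Continuous fun ε => ∫ x in ε..L, I x := by
      have h1 : Continuous fun ε => -∫ x in L..ε, I x :=
        (intervalIntegral.continuous_primitive (fun a b => hIc.intervalIntegrable a b) L).neg
      convert h1 using 2 with ε
      exact intervalIntegral.integral_symm _ _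
    exact (this.tendsto 0).mono_left nhdsWithin_le_nhds
  have hfin : G L - 0 ≤ ∫ x in (0:ℝ)..L, I x := by
    refine le_of_tendsto_of_tendsto (tendsto_const_nhds.sub hGlim) hIlim ?_
    filter_upwards [Ioo_mem_nhdsGT hL] with ε hε
    exact key ε hε.1 hε.2
  refine le_trans ?_ hfin
  simp only [hG, hn, hvL, hlam]
  have hul := hup L
  have hr := Real.rpow_pos_of_pos hul (p - 1)
  have e : (σ ^ 2 * u L - ρ * u L ^ (p - 1)) / (-σ * u L) * φ L ^ 2 - 0
    = -σ * φ L ^ 2 + ρ * u L ^ (p - 1) / (σ * u L) * φ L ^ 2 := by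
    field_simp
    ring
  rw [e]
  have : 0 ≤ ρ * u L ^ (p - 1) / (σ * u L) * φ L ^ 2 := by positivity
  linarith

lemma half_outer {lam σ L : ℝ} {φ : ℝ → ℝ} (hlam : lam = σ ^ 2)
    (hφ : ContDiff ℝ 1 φ) (hφs : HasCompactSupport φ) :
    σ * φ L ^ 2 ≤ ∫ x in Ioi L, ((deriv φ x) ^ 2 + lam * φ x ^ 2) := by
  have hφc := hφ.continuous
  have hφ'c : Continuous (deriv φ) := hφ.continuous_deriv le_rfl
  have hφd : ∀ x, HasDerivAt φ (deriv φ x) x := fun x =>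
    (hφ.differentiable one_ne_zero x).hasDerivAt
  set f : ℝ → ℝ := fun x => -σ * φ x ^ 2 with hf
  have hfd : ContDiff ℝ 1 f := contDiff_const.mul (hφ.pow 2)
  have hfs : HasCompactSupport f := by
    apply hφs.mono
    intro x hx hx'
    apply hx
    simp [hf, hx']
  have h1 := hfs.integral_Ioi_deriv_eq hfd L
  have h2 : ∫ x in Ioi L, deriv f x ≤ ∫ x in Ioi L, ((deriv φ x) ^ 2 + lam * φ x ^ 2) := by
    apply setIntegral_mono
    · exact ((hfd.continuous_deriv le_rfl).integrable_of_hasCompactSupport hfs.deriv).integrableOn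
    · apply Integrable.integrableOn
      apply Continuous.integrable_of_hasCompactSupport (by fun_prop)
      apply HasCompactSupport.add
      · exact hφs.deriv.mono (fun x hx hx' => hx (by simp [hx']))
      · exact hφs.mono (fun x hx hx' => hx (by simp [hx']))
    · intro x
      have : HasDerivAt f (-σ * (2 * φ x * deriv φ x)) x := by
        refine (((hφd x).pow 2).const_mul (-σ)).congr_deriv ?_
        simp
      simp only [this.deriv, hlam]
      nlinarith [sq_nonneg (deriv φ x + σ * φ x)]
  rw [h1] at h2
  simpa [hf] using h2

lemma half_total {p lam σ ρ L : ℝ} {u v φ : ℝ → ℝ} (hσ : 0 < σ) (hlam : lam = σ ^ 2)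
    (hL : 0 < L) (hρ : 0 < ρ) (hu : ∀ x, HasDerivAt u (v x) x) (hvc : Continuous v)
    (hup : ∀ x, 0 < u x) (hv0 : v 0 = 0) (hvn : ∀ x, 0 < x → v x < 0) (hvL : v L = -σ * u L)
    (hv : ∀ x, 0 ≤ x → x < L → HasDerivAt v (lam * u x - ρ * u x ^ (p - 1)) x)
    (hn0 : lam * u 0 - ρ * u 0 ^ (p - 1) ≠ 0)
    (hφ : ContDiff ℝ 1 φ) (hφ0 : φ 0 = 0) (hφs : HasCompactSupport φ) (J : ℝ → ℝ)
    (hJ : IntegrableOn J (Ioi 0))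
    (hJ1 : ∀ x, 0 < x → x ≤ L →
      J x = (deriv φ x) ^ 2 + (lam - (p - 1) * ρ * u x ^ (p - 2)) * φ x ^ 2)
    (hJ2 : ∀ x, L < x → J x = (deriv φ x) ^ 2 + lam * φ x ^ 2) :
    0 ≤ ∫ x in Ioi 0, J x := by
  have h1 := half_inner hσ hlam hL hρ hu hvc hup hv0 hvn hvL hv hn0 hφ hφ0
  have h2 := half_outer (L := L) hlam hφ hφs
  have e1 : ∫ x in (0:ℝ)..L, ((deriv φ x) ^ 2 + (lam - (p - 1) * ρ * u x ^ (p - 2)) * φ x ^ 2)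
      = ∫ x in Ioc 0 L, J x := by
    rw [intervalIntegral.integral_of_le hL.le]
    apply setIntegral_congr_fun measurableSet_Ioc
    intro x hx
    exact (hJ1 x hx.1 hx.2).symm
  have e2 : ∫ x in Ioi L, ((deriv φ x) ^ 2 + lam * φ x ^ 2) = ∫ x in Ioi L, J x := by
    apply setIntegral_congr_fun measurableSet_Ioi
    intro x hx
    exact (hJ2 x hx).symm
  rw [e1] at h1
  rw [e2] at h2
  have : ∫ x in Ioi 0, J x = (∫ x in Ioc 0 L, J x) + ∫ x in Ioi L, J x := by
    rw [← Ioc_union_Ioi_eq_Ioi hL.le]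
    refine setIntegral_union ?_ measurableSet_Ioi (hJ.mono_set Ioc_subset_Ioi_self)
      (hJ.mono_set (Ioi_subset_Ioi hL.le))
    exact Set.disjoint_left.2 fun x hx hx' => not_lt.2 hx.2 hx'
  rw [this]
  linarith

lemma exists_s {p : ℝ} (hp : 6 < p) {k : ℝ → ℝ} (hk : IsK p k) (μ L C0 : ℝ) (hμ : 0 < μ)
    (hL : 0 < L) (hC0 : 0 < C0) :
    ∃ s, C0 * Real.exp s ^ (2 / (p - 2)) * (TT p k s / L) ^ (-(1 - 2 * (2 / (p - 2)))) *
      (2 * NN p k s + 1) = μ := by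
  have hp2 : 0 < p - 2 := by linarith
  set a := 2 / (p - 2) with ha
  have ha0 : 0 < a := by positivity
  have hν : 0 < 1 - 2 * a := by
    have : a < 1 / 2 := by rw [ha, div_lt_div_iff₀ hp2 two_pos]; linarith
    linarith
  set ν := 1 - 2 * a with hνd
  obtain ⟨C, hC, hNC⟩ := NN_bound hp hk
  have hcont : Continuous fun s => C0 * Real.exp s ^ a * (TT p k s / L) ^ (-ν) *
      (2 * NN p k s + 1) := by
    have h1 : Continuous fun s => Real.exp s ^ a :=
      Real.continuous_exp.rpow_const (fun x => Or.inl (Real.exp_pos x).ne')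
    have h2 : Continuous fun s => (TT p k s / L) ^ (-ν) :=
      ((TT_cont hp hk).div_const L).rpow_const
        (fun x => Or.inl (div_pos (TT_pos hp hk x) hL).ne')
    have h3 := NN_cont hp hk
    fun_prop
  refine mem_range_of_exists_le_of_exists_ge hcont ?_ ?_
  · have hD : 0 < C0 * (2 * C + 1) := by positivity
    have h1 := (tendsto_rpow_neg_atTop hν).eventually
      (gt_mem_nhds (div_pos hμ hD : 0 < μ / (C0 * (2 * C + 1))))
    obtain ⟨R, hR⟩ := eventually_atTop.1 h1
    refine ⟨-(p * L * max R 0), ?_⟩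
    set s := -(p * L * max R 0) with hs
    have hs0 : s ≤ 0 := by
      have : 0 ≤ max R 0 := le_max_right _ _
      rw [hs]; apply neg_nonpos.2; positivity
    have hT : R ≤ TT p k s / L := by
      have := TT_ge hp hk s
      rw [le_div_iff₀ hL]
      refine le_trans ?_ this
      rw [hs]
      have e : - -(p * L * max R 0) / p = max R 0 * L := by field_simp
      rw [e]
      exact mul_le_mul_of_nonneg_right (le_max_left _ _) hL.le
    have h2 := hR _ hT
    have h3 : Real.exp s ^ a * (2 * NN p k s + 1) ≤ 2 * C + 1 := by
      have h4 := hNC s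
      have h5 : Real.exp s ^ a ≤ 1 :=
        Real.rpow_le_one (Real.exp_pos s).le (Real.exp_le_one_iff.2 hs0) ha0.le
      nlinarith
    have h6 : 0 ≤ (TT p k s / L) ^ (-ν) :=
      Real.rpow_nonneg (div_pos (TT_pos hp hk s) hL).le _
    calc C0 * Real.exp s ^ a * (TT p k s / L) ^ (-ν) * (2 * NN p k s + 1)
        = C0 * (TT p k s / L) ^ (-ν) * (Real.exp s ^ a * (2 * NN p k s + 1)) := by ring
      _ ≤ C0 * (TT p k s / L) ^ (-ν) * (2 * C + 1) := by gcongr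
      _ = (C0 * (2 * C + 1)) * (TT p k s / L) ^ (-ν) := by ring
      _ ≤ (C0 * (2 * C + 1)) * (μ / (C0 * (2 * C + 1))) := by gcongr
      _ = μ := by field_simp
  · refine ⟨max (-Real.log L) (Real.log (μ / C0) / a), ?_⟩
    set s := max (-Real.log L) (Real.log (μ / C0) / a) with hs
    have hT0 := TT_pos hp hk s
    have hT : TT p k s / L ≤ 1 := by
      rw [div_le_one hL]
      refine (TT_le hp hk s).trans ?_
      have : -s ≤ Real.log L := by
        have := le_max_left (-Real.log L) (Real.log (μ / C0) / a)
        linarith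
      calc Real.exp (-s) ≤ Real.exp (Real.log L) := Real.exp_le_exp.2 this
        _ = L := Real.exp_log hL
    have h1 : 1 ≤ (TT p k s / L) ^ (-ν) :=
      Real.one_le_rpow_of_pos_of_le_one_of_nonpos (by positivity) hT (by linarith)
    have h2 : μ / C0 ≤ Real.exp s ^ a := by
      rw [← Real.exp_mul]
      have : Real.log (μ / C0) ≤ s * a := by
        rw [← div_le_iff₀ ha0]; exact le_max_right _ _
      calc μ / C0 = Real.exp (Real.log (μ / C0)) := (Real.exp_log (by positivity)).symm
        _ ≤ _ := Real.exp_le_exp.2 this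
    have h3 := NN_nonneg (k := k) hp s
    calc μ = C0 * (μ / C0) * 1 * 1 := by field_simp
      _ ≤ C0 * Real.exp s ^ a * (TT p k s / L) ^ (-ν) * (2 * NN p k s + 1) := by
        gcongr
        linarith

lemma prof_mass {p β T N : ℝ} {t θ : ℝ → ℝ} (h : IsProf p β T N t θ) (hT : 0 < T) :
    ∫ x, Real.exp (2 * t x) = 2 * N + 1 := by
  have htc : Continuous t := continuous_iff_continuousAt.2 fun x => (h.der x).continuousAt
  have e : ∀ x, Real.exp (2 * t x) = (fun y => Real.exp (2 * t y)) |x| := by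
    intro x
    rcases abs_choice x with hx | hx
    · simp only [hx]
    · simp only [hx, h.even]
  have h1 : ∫ x, Real.exp (2 * t x) = 2 * ∫ x in Ioi 0, Real.exp (2 * t x) := by
    rw [← integral_comp_abs]
    exact integral_congr_ae (Eventually.of_forall e)
  have e2 : ∀ x ∈ Ioi T, Real.exp (2 * t x) = Real.exp (2 * T) * Real.exp (-2 * x) := by
    intro x hx
    rw [h.tail x (le_of_lt hx), ← Real.exp_add]
    congr 1; ring
  have i2 : IntegrableOn (fun x => Real.exp (2 * t x)) (Ioi T) := by
    have : IntegrableOn (fun x => Real.exp (2 * T) * Real.exp (-2 * x)) (Ioi T) :=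
      (integrableOn_exp_mul_Ioi (by norm_num) T).const_mul _
    exact this.congr_fun (fun x hx => (e2 x hx).symm) measurableSet_Ioi
  have v2 : ∫ x in Ioi T, Real.exp (2 * t x) = 1 / 2 := by
    rw [setIntegral_congr_fun measurableSet_Ioi e2, integral_const_mul,
      integral_exp_mul_Ioi (by norm_num)]
    have : Real.exp (2 * T) * Real.exp (-2 * T) = 1 := by
      rw [← Real.exp_add]; simp
    linear_combination this / 2
  have i1 : IntegrableOn (fun x => Real.exp (2 * t x)) (Ioc 0 T) := by
    apply Continuous.integrableOn_Ioc; fun_prop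
  have : ∫ x in Ioi 0, Real.exp (2 * t x) = N + 1 / 2 := by
    have hdis : Disjoint (Ioc 0 T) (Ioi T) :=
      Set.disjoint_left.2 fun x hx hx' => not_lt.2 hx.2 hx'
    rw [← Ioc_union_Ioi_eq_Ioi hT.le, setIntegral_union hdis measurableSet_Ioi i1 i2, v2,
      ← intervalIntegral.integral_of_le hT.le, h.mass]
  rw [h1, this]; ring

lemma morse {p lam σ ρ L : ℝ} {u U V : ℝ → ℝ} (hσ : 0 < σ) (hlam : lam = σ ^ 2)
    (hL : 0 < L) (hρ : 0 < ρ) (hu : ∀ x, HasDerivAt U (V x) x) (hvc : Continuous V)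
    (hup : ∀ x, 0 < U x) (hv0 : V 0 = 0) (hvn : ∀ x, 0 < x → V x < 0) (hvL : V L = -σ * U L)
    (hv : ∀ x, 0 ≤ x → x < L → HasDerivAt V (lam * U x - ρ * U x ^ (p - 1)) x)
    (hn0 : lam * U 0 - ρ * U 0 ^ (p - 1) ≠ 0) (hev : ∀ x, U (-x) = U x)
    (huU : ∀ x, u x = U (x - L))
    (φ : ℝ → ℝ) (hφ : ContDiff ℝ 1 φ) (hφs : HasCompactSupport φ) (hφ0 : φ L = 0) :
    0 ≤ ∫ x : ℝ, ((deriv φ x) ^ 2 +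
              (lam - (p - 1) * ρ * Set.indicator (Set.Icc 0 (2 * L)) (fun _ => (1 : ℝ)) x
                * (u x) ^ (p - 2)) * (φ x) ^ 2) := by
  have hUc : Continuous U := continuous_iff_continuousAt.2 fun x => (hu x).continuousAt
  have huc : Continuous u := by
    have : u = fun x => U (x - L) := funext huU
    rw [this]; fun_prop
  have hφc := hφ.continuous
  have hφ'c : Continuous (deriv φ) := hφ.continuous_deriv le_rfl
  have hupc : Continuous fun x => u x ^ (p - 2) :=
    huc.rpow_const (fun x => Or.inl (by rw [huU]; exact (hup _).ne'))
  set J : ℝ → ℝ := fun x => ((deriv φ x) ^ 2 +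
              (lam - (p - 1) * ρ * Set.indicator (Set.Icc 0 (2 * L)) (fun _ => (1 : ℝ)) x
                * (u x) ^ (p - 2)) * (φ x) ^ 2) with hJ
  have hJin : ∀ x, 0 ≤ x → x ≤ 2 * L → J x = (deriv φ x) ^ 2 +
      (lam - (p - 1) * ρ * U (x - L) ^ (p - 2)) * φ x ^ 2 := by
    intro x h1 h2
    simp only [hJ]
    rw [indicator_of_mem (show x ∈ Icc 0 (2 * L) from ⟨h1, h2⟩), huU, mul_one]
  have hJout : ∀ x, x ∉ Icc 0 (2 * L) → J x = (deriv φ x) ^ 2 + lam * φ x ^ 2 := by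
    intro x h1
    simp only [hJ]
    rw [indicator_of_notMem h1]
    ring
  have hJi : Integrable J := by
    have i1 : Integrable fun x => (deriv φ x) ^ 2 + lam * φ x ^ 2 := by
      apply Continuous.integrable_of_hasCompactSupport (by fun_prop)
      apply HasCompactSupport.add
      · exact hφs.deriv.mono (fun x hx hx' => hx (by simp [hx']))
      · exact hφs.mono (fun x hx hx' => hx (by simp [hx']))
    have i2 : Integrable fun x => (p - 1) * ρ * (u x) ^ (p - 2) * φ x ^ 2 := by
      apply Continuous.integrable_of_hasCompactSupport (by fun_prop)
      exact hφs.mono (fun x hx hx' => hx (by simp [hx']))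
    have i3 := i1.sub (i2.indicator (measurableSet_Icc (a := 0) (b := 2 * L)))
    refine i3.congr (Eventually.of_forall fun x => ?_)
    by_cases hx : x ∈ Icc 0 (2 * L)
    · simp only [hJ, Pi.sub_apply, indicator_of_mem hx]; ring
    · simp only [hJ, Pi.sub_apply, indicator_of_notMem hx]; ring
  have hR : 0 ≤ ∫ x in Ioi 0, J (x + L) := by
    refine half_total (φ := fun x => φ (x + L)) hσ hlam hL hρ hu hvc hup hv0 hvn hvL hv hn0
      (hφ.comp (contDiff_id.add contDiff_const)) (by simpa using hφ0)
      (hφs.comp_homeomorph (Homeomorph.addRight L)) _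
      (hJi.comp_add_right L).integrableOn ?_ ?_
    · intro x h1 h2
      rw [hJin _ (by linarith) (by linarith), deriv_comp_add_const]
      simp
    · intro x h1
      rw [hJout _ (fun hx => by have := hx.2; linarith), deriv_comp_add_const]
  have hLf : 0 ≤ ∫ x in Ioi 0, J (L - x) := by
    refine half_total (φ := fun x => φ (L - x)) hσ hlam hL hρ hu hvc hup hv0 hvn hvL hv hn0
      (hφ.comp (contDiff_const.sub contDiff_id)) (by simpa using hφ0)
      (hφs.comp_homeomorph (Homeomorph.subLeft L)) _
      (hJi.comp_sub_left L).integrableOn ?_ ?_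
    · intro x h1 h2
      rw [hJin _ (by linarith) (by linarith), deriv_comp_const_sub]
      have : L - x - L = -x := by ring
      rw [this, hev]
      ring
    · intro x h1
      rw [hJout _ (fun hx => by have := hx.1; linarith), deriv_comp_const_sub]
      ring
  have e1 : ∫ x, J x = ∫ x, J (x + L) := (integral_add_right_eq_self J L).symm
  have hi := hJi.comp_add_right L
  have e2 := intervalIntegral.integral_Iic_add_Ioi (b := 0) hi.integrableOn hi.integrableOn
  have e3 := integral_comp_neg_Ioi 0 (fun x => J (x + L))
  rw [neg_zero] at e3
  have e4 : ∫ x in Ioi 0, J (-x + L) = ∫ x in Ioi 0, J (L - x) := by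
    congr 1; funext x; congr 1; ring
  rw [e1, ← e2, ← e3, e4]
  linarith

/-- Proposition 3.4 of the paper, on the real line with compact core `[0, ℓ]`: for a.e.
`ρ ∈ [1/2, 1]` there is a positive normalized solution of `-u'' + λu = ρ χ_{[0,ℓ]} u^{p-1}`
with positive Lagrange multiplier and Morse index at most 2. -/
theorem stmt_8 (p μ ℓ : ℝ) (hp : 6 < p) (hμ : 0 < μ) (hℓ : 0 < ℓ) :
    ∀ᵐ ρ ∂(volume : Measure ℝ), ρ ∈ Set.Icc (1 / 2 : ℝ) 1 →
      ∃ (lam : ℝ) (u : ℝ → ℝ), 0 < lam ∧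
        ContDiff ℝ 1 u ∧
        (∀ x : ℝ, x ≠ 0 → x ≠ ℓ → DifferentiableAt ℝ (deriv u) x) ∧
        (∀ x : ℝ, 0 < u x) ∧
        Integrable (fun x : ℝ => (u x) ^ 2) ∧
        Integrable (fun x : ℝ => (deriv u x) ^ 2) ∧
        (∫ x : ℝ, (u x) ^ 2) = μ ∧
        (∀ x : ℝ, x ≠ 0 → x ≠ ℓ →
          -(deriv (deriv u) x) + lam * u x
            = ρ * Set.indicator (Set.Icc 0 ℓ) (fun _ => (1 : ℝ)) x * (u x) ^ (p - 1)) ∧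
        (∀ W : Submodule ℝ (ℝ → ℝ), FiniteDimensional ℝ W →
          (∀ φ ∈ W, ContDiff ℝ 1 φ ∧ HasCompactSupport φ) →
          (∀ φ ∈ W, φ ≠ 0 →
            (∫ x : ℝ, ((deriv φ x) ^ 2 +
              (lam - (p - 1) * ρ * Set.indicator (Set.Icc 0 ℓ) (fun _ => (1 : ℝ)) x
                * (u x) ^ (p - 2)) * (φ x) ^ 2)) < 0) →
          Module.finrank ℝ W ≤ 2) := by
  refine Eventually.of_forall fun ρ hρI => ?_
  have hρ : 0 < ρ := by linarith [hρI.1]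
  obtain ⟨L, rfl⟩ : ∃ L, ℓ = 2 * L := ⟨ℓ / 2, by ring⟩
  have hL : 0 < L := by linarith
  have hp2 : 0 < p - 2 := by linarith
  obtain ⟨k, hk⟩ := exists_k p hp
  obtain ⟨s, hs⟩ := exists_s hp hk μ L ((p / 2 / ρ) ^ (2 / (p - 2))) hμ hL (by positivity)
  obtain ⟨t, θ, hP⟩ := exists_prof hp hk s
  have hT := TT_pos hp hk s
  set T := TT p k s with hTd
  set N := NN p k s
  set β := Real.exp s with hβd
  have hβ : 0 < β := Real.exp_pos s
  obtain ⟨σ, hσd⟩ : ∃ σ, σ = T / L := ⟨_, rfl⟩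
  have hσ : 0 < σ := by rw [hσd]; positivity
  have hσL : σ * L = T := by rw [hσd]; field_simp
  rw [← hσd] at hs
  set B := (σ ^ 2 * (p / 2 / ρ) * β) ^ (1 / (p - 2)) with hB
  have hp0 : 0 < p := by linarith
  have hB0 : 0 < B := by positivity
  have hBp : ρ * B ^ (p - 2) = σ ^ 2 * (p / 2) * β := by
    rw [hB, ← Real.rpow_mul (by positivity), one_div_mul_cancel hp2.ne', Real.rpow_one]
    field_simp
  have hBmass : B ^ 2 * σ⁻¹ * (2 * N + 1) = μ := by
    rw [← hs]
    have e1 : B ^ 2 = (p / 2 / ρ) ^ (2 / (p - 2)) * β ^ (2 / (p - 2)) * σ ^ (2 * (2 / (p - 2))) := by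
      rw [hB, ← Real.rpow_natCast, ← Real.rpow_mul (by positivity)]
      have : 1 / (p - 2) * ((2 : ℕ) : ℝ) = 2 / (p - 2) := by push_cast; ring
      rw [this, Real.mul_rpow (by positivity) hβ.le, Real.mul_rpow (by positivity) (by positivity),
        Real.rpow_mul hσ.le, Real.rpow_two]
      ring
    have e2 : σ ^ (-(1 - 2 * (2 / (p - 2)))) = σ ^ (2 * (2 / (p - 2))) * σ⁻¹ := by
      rw [← Real.rpow_neg_one, ← Real.rpow_add hσ]
      congr 1; ring
    rw [e1, e2]
    ring
  have htc : Continuous t := continuous_iff_continuousAt.2 fun x => (hP.der x).continuousAt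
  have hθc := hP.cont
  set U : ℝ → ℝ := fun y => B * Real.exp (t (σ * y)) with hU
  set V : ℝ → ℝ := fun y => -σ * θ (σ * y) * U y with hV
  have hUp : ∀ y, 0 < U y := fun y => by positivity
  have hUd : ∀ y, HasDerivAt U (V y) y := by
    intro y
    have h1 : HasDerivAt (fun y => σ * y) σ y := by simpa using (hasDerivAt_id y).const_mul σ
    have h2 : HasDerivAt (fun y => t (σ * y)) (-θ (σ * y) * σ) y := (hP.der _).comp y h1
    refine (h2.exp.const_mul B).congr_deriv ?_
    simp only [hV, hU]; ring
  have hUc : Continuous U := continuous_iff_continuousAt.2 fun x => (hUd x).continuousAt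
  have hVc : Continuous V := by fun_prop
  have habs : ∀ y, |y| < L → |σ * y| < T := by
    intro y hy
    rw [abs_mul, abs_of_pos hσ, ← hσL]
    gcongr
  have hUpow : ∀ y, ρ * U y ^ (p - 1) = σ ^ 2 * (p / 2) * β * Real.exp ((p - 2) * t (σ * y)) * U y := by
    intro y
    have : p - 1 = (p - 2) + 1 := by ring
    rw [this, Real.rpow_add_one (hUp y).ne', ← hBp]
    have : U y ^ (p - 2) = B ^ (p - 2) * Real.exp ((p - 2) * t (σ * y)) := by
      simp only [hU]
      rw [Real.mul_rpow hB0.le (Real.exp_pos _).le, ← Real.exp_mul, mul_comm (t _)]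
    rw [this]; ring
  have hsec : ∀ y, |y| < L → σ ^ 2 * U y - ρ * U y ^ (p - 1)
      = σ ^ 2 * U y * (θ (σ * y) ^ 2 - β / 2 * DD p (t (σ * y))) := by
    intro y hy
    have h1 := hP.en (σ * y) (habs y hy).le
    rw [hUpow]
    unfold DD
    linear_combination (-σ ^ 2 * U y) * (-h1)
  have hVd : ∀ y, |y| < L → HasDerivAt V (σ ^ 2 * U y - ρ * U y ^ (p - 1)) y := by
    intro y hy
    have h1 : HasDerivAt (fun y => σ * y) σ y := by simpa using (hasDerivAt_id y).const_mul σ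
    have h2 : HasDerivAt (fun y => θ (σ * y)) (β / 2 * DD p (t (σ * y)) * σ) y :=
      (hP.der2 _ (habs y hy)).comp y h1
    refine ((h2.const_mul (-σ)).mul (hUd y)).congr_deriv ?_
    rw [hsec y hy]
    simp only [hV]; ring
  have hθ0 : θ 0 = 0 := by
    have := hP.odd 0
    rw [neg_zero] at this
    linarith
  have hθone : ∀ y, L ≤ y → θ (σ * y) = 1 := by
    intro y hy
    apply hP.one
    rw [← hσL]; gcongr
  have hVd2 : ∀ y, L < |y| → HasDerivAt V (σ ^ 2 * U y) y := by
    intro y hy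
    rcases lt_abs.1 hy with h | h
    · have he : V =ᶠ[nhds y] fun z => -σ * U z := by
        filter_upwards [lt_mem_nhds h] with z hz
        simp only [hV, hθone z (le_of_lt hz)]; ring
      refine (((hUd y).const_mul (-σ)).congr_of_eventuallyEq he).congr_deriv ?_
      simp only [hV, hθone y h.le]; ring
    · have hm : ∀ z, z < -L → θ (σ * z) = -1 := by
        intro z hz
        have := hθone (-z) (by linarith)
        rw [mul_neg, hP.odd] at this
        linarith
      have he : V =ᶠ[nhds y] fun z => σ * U z := by
        filter_upwards [gt_mem_nhds (show y < -L by linarith)] with z hz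
        simp only [hV, hm z hz]; ring
      refine (((hUd y).const_mul σ).congr_of_eventuallyEq he).congr_deriv ?_
      simp only [hV, hm y (by linarith)]; ring
  have hUmass : ∫ y, U y ^ 2 = μ := by
    have e : ∀ y, U y ^ 2 = B ^ 2 * (fun z => Real.exp (2 * t z)) (σ * y) := by
      intro y
      simp only [hU, mul_pow, ← Real.exp_nat_mul]
      norm_num
    simp only [e]
    rw [integral_const_mul, Measure.integral_comp_mul_left (fun z => Real.exp (2 * t z)),
      prof_mass hP hT, abs_of_pos (inv_pos.2 hσ), smul_eq_mul, ← hBmass]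
    ring
  have hUi : Integrable fun y => U y ^ 2 := by
    by_contra hcon
    rw [integral_undef hcon] at hUmass
    linarith
  have hVi : Integrable fun y => V y ^ 2 := by
    refine (hUi.const_mul (σ ^ 2)).mono' (by fun_prop) (Eventually.of_forall fun y => ?_)
    rw [Real.norm_of_nonneg (sq_nonneg _)]
    have e : V y ^ 2 = σ ^ 2 * U y ^ 2 * θ (σ * y) ^ 2 := by simp only [hV]; ring
    rw [e]
    have := hP.sq (σ * y)
    have h0 : 0 ≤ σ ^ 2 * U y ^ 2 := by positivity
    nlinarith
  set u : ℝ → ℝ := fun x => U (x - L) with hu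
  have hud : ∀ x, HasDerivAt u (V (x - L)) x := fun x => (hUd (x - L)).comp_sub_const x L
  have hderiv : deriv u = fun x => V (x - L) := funext fun x => (hud x).deriv
  have hd2 : ∀ x, x ≠ 0 → x ≠ 2 * L → HasDerivAt (deriv u) (σ ^ 2 * u x
      - ρ * Set.indicator (Set.Icc 0 (2 * L)) (fun _ => (1 : ℝ)) x * (u x) ^ (p - 1)) x := by
    intro x h0 h1
    rw [hderiv]
    by_cases hx : x ∈ Icc 0 (2 * L)
    · rw [indicator_of_mem hx, mul_one]
      have a0 := lt_of_le_of_ne hx.1 h0.symm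
      have a1 := lt_of_le_of_ne hx.2 h1
      exact (hVd (x - L) (abs_lt.2 ⟨by linarith, by linarith⟩)).comp_sub_const x L
    · rw [indicator_of_notMem hx]
      have : L < |x - L| := by
        rw [lt_abs]
        by_contra hcon
        push Not at hcon
        exact hx ⟨by linarith [hcon.2], by linarith [hcon.1]⟩
      refine ((hVd2 (x - L) this).comp_sub_const x L).congr_deriv ?_
      simp [hu]
  refine ⟨σ ^ 2, u, by positivity, ?_, ?_, fun x => hUp _, hUi.comp_sub_right L, ?_, ?_, ?_, ?_⟩
  · rw [contDiff_one_iff_deriv]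
    refine ⟨fun x => (hud x).differentiableAt, ?_⟩
    rw [hderiv]; fun_prop
  · exact fun x h0 h1 => (hd2 x h0 h1).differentiableAt
  · rw [hderiv]; exact hVi.comp_sub_right L
  · rw [← hUmass]
    exact integral_sub_right_eq_self (fun y => U y ^ 2) L
  · intro x h0 h1
    rw [(hd2 x h0 h1).deriv]; ring
  · intro W hW hWc hWn
    by_contra hcon
    push Not at hcon
    let ev : W →ₗ[ℝ] ℝ := (LinearMap.proj L : (ℝ → ℝ) →ₗ[ℝ] ℝ).comp W.subtype
    have hker : LinearMap.ker ev ≠ ⊥ :=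
      LinearMap.ker_ne_bot_of_finrank_lt (by rw [Module.finrank_self]; omega)
    obtain ⟨⟨φ, hφW⟩, hφk, hφ0⟩ := Submodule.exists_mem_ne_zero_of_ne_bot hker
    have hφL : φ L = 0 := hφk
    have hφne : φ ≠ 0 := fun h => hφ0 (Subtype.ext h)
    have h1 := hWn φ hφW hφne
    obtain ⟨hc, hcs⟩ := hWc φ hφW
    have h2 := morse (p := p) (u := u) hσ rfl hL hρ hUd hVc hUp
      (by simp [hV, hθ0])
      (fun x hx => by
        have := hP.pos (σ * x) (by positivity)
        have h3 := hUp x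
        have : 0 < σ * θ (σ * x) * U x := by positivity
        simp only [hV]; linarith)
      (by simp only [hV, hθone L le_rfl]; ring)
      (fun x h0 h1 => hVd x (abs_lt.2 ⟨by linarith, h1⟩))
      (by
        rw [hsec 0 (by simpa using hL), mul_zero, hθ0]
        have := DD_ge p (t 0) hp
        have h3 := hUp 0
        have : 0 < σ ^ 2 * U 0 * (β / 2 * DD p (t 0)) := by positivity
        intro h4
        nlinarith)
      (fun x => by simp only [hU, mul_neg, hP.even]) (fun x => rfl) φ hc hcs hφL
    linarith
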